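/- Let (X,T) be a nonautonomous dynamical system, E ⊂ X_0 a Borel set, s ∈ ℝ, μ a Borel probability measure on X_0, and f = (f_k) a sequence of continuous real-valued potentials. Then: (1) if P̄_μ(T,f,x) ≤ s for all x ∈ E, then P^P(T,f,E) ≤ s; and (2) if f is equicontinuous, P̄_μ(T,f,x) ≥ s for all x ∈ E, and μ(E) > 0, then P^P(T,f,E) ≥ s. -/

import Mathlib

open Filter MeasureTheory Set
open scoped ENNReal Topology

namespace NDS

variable {X : ℕ → Type*}

/-- Iterates `T^j : X 0 → X j` of a nonautonomous dynamical system `T`. -/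
def iter (T : ∀ k, X k → X (k + 1)) : ∀ j, X 0 → X j
  | 0 => fun x => x
  | j + 1 => fun x => T j (iter T j x)

/-- The Birkhoff-type sum `S_n^T f (x) = ∑_{j<n} f_j (T^j x)`. -/
def birk (T : ∀ k, X k → X (k + 1)) (f : ∀ k, X k → ℝ) (n : ℕ) (x : X 0) : ℝ :=
  ∑ j ∈ Finset.range n, f j (iter T j x)

/-- The uniform norm `‖f‖ = sup_k sup_x |f_k x|` of a sequence of potentials. -/
noncomputable def fnorm (f : ∀ k, X k → ℝ) : ℝ :=
  ⨆ k : ℕ, ⨆ x : X k, |f k x|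

/-- `log : ℝ≥0∞ → EReal` with the conventions `log 0 = -∞`, `log ∞ = ∞`. -/
noncomputable def elog (x : ℝ≥0∞) : EReal :=
  if x = 0 then ⊥ else if x = ⊤ then ⊤ else ((Real.log x.toReal : ℝ) : EReal)

/-- The nonnegative part of an extended real, as an element of `ℝ≥0∞`. -/
noncomputable def toENN (x : EReal) : ℝ≥0∞ :=
  if x = ⊤ then ⊤ else ENNReal.ofReal x.toReal

/-- The canonical map `ℝ≥0∞ → EReal`. -/
noncomputable def ofENN (x : ℝ≥0∞) : EReal :=
  if x = ⊤ then ⊤ else ((x.toReal : ℝ) : EReal)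

/-- The integral of an extended-real-valued function: the difference of the lower
integrals of its positive and negative parts. -/
noncomputable def eInt {α : Type*} [MeasurableSpace α] (μ : Measure α) (g : α → EReal) : EReal :=
  ofENN (∫⁻ x, toENN (g x) ∂μ) - ofENN (∫⁻ x, toENN (-g x) ∂μ)

section Metric

variable [∀ k, MetricSpace (X k)]

/-- The open Bowen ball `B_n^T(x,ε)`. -/
def bowenBall (T : ∀ k, X k → X (k + 1)) (n : ℕ) (ε : ℝ) (x : X 0) : Set (X 0) :=
  {y | ∀ j < n, dist (iter T j x) (iter T j y) < ε}

/-- The closed Bowen ball `B̄_n^T(x,ε)`. -/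
def bowenClosedBall (T : ∀ k, X k → X (k + 1)) (n : ℕ) (ε : ℝ) (x : X 0) : Set (X 0) :=
  {y | ∀ j < n, dist (iter T j x) (iter T j y) ≤ ε}

/-- Equicontinuity of a sequence of potentials `f = (f_k)`. -/
def EquicontPotential (f : ∀ k, X k → ℝ) : Prop :=
  ∀ ε : ℝ, 0 < ε → ∃ δ : ℝ, 0 < δ ∧ ∀ k, ∀ x y : X k, dist x y < δ → |f k x - f k y| < ε

/-- The supremum of the Birkhoff sum `S_n^T f` over a subset `A` of `X 0`. -/
noncomputable def supBirk (T : ∀ k, X k → X (k + 1)) (f : ∀ k, X k → ℝ) (n : ℕ)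
    (A : Set (X 0)) : ℝ :=
  ⨆ y : A, birk T f n (y : X 0)

/-- Measure-theoretic lower local pressure `P̲_μ(T,f,x)`. -/
noncomputable def localLowerPres [MeasurableSpace (X 0)] (μ : Measure (X 0))
    (T : ∀ k, X k → X (k + 1)) (f : ∀ k, X k → ℝ) (x : X 0) : EReal :=
  ⨆ (ε : ℝ) (_ : 0 < ε),
    liminf (fun n : ℕ =>
      (((n : ℝ)⁻¹ : ℝ) : EReal) *
        (-(elog (μ (bowenBall T n ε x))) + ((birk T f n x : ℝ) : EReal))) atTop

/-- Measure-theoretic upper local pressure `P̄_μ(T,f,x)`. -/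
noncomputable def localUpperPres [MeasurableSpace (X 0)] (μ : Measure (X 0))
    (T : ∀ k, X k → X (k + 1)) (f : ∀ k, X k → ℝ) (x : X 0) : EReal :=
  ⨆ (ε : ℝ) (_ : 0 < ε),
    limsup (fun n : ℕ =>
      (((n : ℝ)⁻¹ : ℝ) : EReal) *
        (-(elog (μ (bowenBall T n ε x))) + ((birk T f n x : ℝ) : EReal))) atTop

/-- Measure-theoretic lower local entropy `h̲_μ(T,x)`. -/
noncomputable def localLowerEnt [MeasurableSpace (X 0)] (μ : Measure (X 0))
    (T : ∀ k, X k → X (k + 1)) (x : X 0) : EReal :=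
  ⨆ (ε : ℝ) (_ : 0 < ε),
    liminf (fun n : ℕ =>
      (((n : ℝ)⁻¹ : ℝ) : EReal) * (-(elog (μ (bowenBall T n ε x))))) atTop

/-- Measure-theoretic upper local entropy `h̄_μ(T,x)`. -/
noncomputable def localUpperEnt [MeasurableSpace (X 0)] (μ : Measure (X 0))
    (T : ∀ k, X k → X (k + 1)) (x : X 0) : EReal :=
  ⨆ (ε : ℝ) (_ : 0 < ε),
    limsup (fun n : ℕ =>
      (((n : ℝ)⁻¹ : ℝ) : EReal) * (-(elog (μ (bowenBall T n ε x))))) atTop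

/-- Measure-theoretic lower pressure `P̲_μ(T,f) = ∫ P̲_μ(T,f,x) dμ(x)`. -/
noncomputable def lowerPres [MeasurableSpace (X 0)] (μ : Measure (X 0))
    (T : ∀ k, X k → X (k + 1)) (f : ∀ k, X k → ℝ) : EReal :=
  eInt μ (fun x => localLowerPres μ T f x)

/-- Measure-theoretic upper pressure `P̄_μ(T,f) = ∫ P̄_μ(T,f,x) dμ(x)`. -/
noncomputable def upperPres [MeasurableSpace (X 0)] (μ : Measure (X 0))
    (T : ∀ k, X k → X (k + 1)) (f : ∀ k, X k → ℝ) : EReal :=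
  eInt μ (fun x => localUpperPres μ T f x)

/-- Measure-theoretic lower entropy `h̲_μ(T) = ∫ h̲_μ(T,x) dμ(x)`. -/
noncomputable def lowerEnt [MeasurableSpace (X 0)] (μ : Measure (X 0))
    (T : ∀ k, X k → X (k + 1)) : EReal :=
  eInt μ (fun x => localLowerEnt μ T x)

/-- Measure-theoretic upper entropy `h̄_μ(T) = ∫ h̄_μ(T,x) dμ(x)`. -/
noncomputable def upperEnt [MeasurableSpace (X 0)] (μ : Measure (X 0))
    (T : ∀ k, X k → X (k + 1)) : EReal :=
  eInt μ (fun x => localUpperEnt μ T x)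

/-- The Bowen premeasure `M^s_{N,ε}(T,f,Z)`: the infimum of
`∑ exp(-n_i s + S_{n_i}^T f(x_i))` over all countable `(N,ε)`-covers of `Z` by open
Bowen balls `B_{n_i}^T(x_i,ε)` with `n_i ≥ N`. -/
noncomputable def bowenPre (T : ∀ k, X k → X (k + 1)) (f : ∀ k, X k → ℝ)
    (s : ℝ) (N : ℕ) (ε : ℝ) (Z : Set (X 0)) : ℝ≥0∞ :=
  ⨅ (D : Set (X 0 × ℕ)) (_ : D.Countable) (_ : ∀ p ∈ D, N ≤ p.2)
      (_ : Z ⊆ ⋃ p ∈ D, bowenBall T p.2 ε p.1),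
    ∑' p : D, ENNReal.ofReal (Real.exp (-(p.1.2 : ℝ) * s + birk T f p.1.2 p.1.1))

/-- `M^s_ε(T,f,Z) = lim_{N→∞} M^s_{N,ε}(T,f,Z)` (an increasing limit). -/
noncomputable def bowenPreLim (T : ∀ k, X k → X (k + 1)) (f : ∀ k, X k → ℝ)
    (s : ℝ) (ε : ℝ) (Z : Set (X 0)) : ℝ≥0∞ :=
  ⨆ N : ℕ, bowenPre T f s N ε Z

/-- The critical value `P^B(T,f,Z,ε) = inf {s : M^s_ε(T,f,Z) = 0}`. -/
noncomputable def bowenCrit (T : ∀ k, X k → X (k + 1)) (f : ∀ k, X k → ℝ)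
    (ε : ℝ) (Z : Set (X 0)) : EReal :=
  ⨅ (s : ℝ) (_ : bowenPreLim T f s ε Z = 0), (s : EReal)

/-- The Bowen (Pesin–Pitskel') topological pressure
`P^B(T,f,Z) = lim_{ε→0} P^B(T,f,Z,ε)` (an increasing limit as `ε ↓ 0`). -/
noncomputable def bowenP (T : ∀ k, X k → X (k + 1)) (f : ∀ k, X k → ℝ)
    (Z : Set (X 0)) : EReal :=
  ⨆ (ε : ℝ) (_ : 0 < ε), bowenCrit T f ε Z

/-- The Bowen topological entropy `h^B(T,Z) = P^B(T,0,Z)`. -/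
noncomputable def bowenEnt (T : ∀ k, X k → X (k + 1)) (Z : Set (X 0)) : EReal :=
  bowenP T (fun k => fun _ : X k => (0 : ℝ)) Z

/-- The premeasure `N^s_{N,ε}(T,f,Z)` using suprema of Birkhoff sums over the balls. -/
noncomputable def nBowenPre (T : ∀ k, X k → X (k + 1)) (f : ∀ k, X k → ℝ)
    (s : ℝ) (N : ℕ) (ε : ℝ) (Z : Set (X 0)) : ℝ≥0∞ :=
  ⨅ (D : Set (X 0 × ℕ)) (_ : D.Countable) (_ : ∀ p ∈ D, N ≤ p.2)
      (_ : Z ⊆ ⋃ p ∈ D, bowenBall T p.2 ε p.1),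
    ∑' p : D, ENNReal.ofReal
      (Real.exp (-(p.1.2 : ℝ) * s + supBirk T f p.1.2 (bowenBall T p.1.2 ε p.1.1)))

/-- `N^s_ε(T,f,Z) = lim_{N→∞} N^s_{N,ε}(T,f,Z)`. -/
noncomputable def nBowenPreLim (T : ∀ k, X k → X (k + 1)) (f : ∀ k, X k → ℝ)
    (s : ℝ) (ε : ℝ) (Z : Set (X 0)) : ℝ≥0∞ :=
  ⨆ N : ℕ, nBowenPre T f s N ε Z

/-- The critical value `Q^B(T,f,Z,ε) = inf {s : N^s_ε(T,f,Z) = 0}`. -/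
noncomputable def nBowenCrit (T : ∀ k, X k → X (k + 1)) (f : ∀ k, X k → ℝ)
    (ε : ℝ) (Z : Set (X 0)) : EReal :=
  ⨅ (s : ℝ) (_ : nBowenPreLim T f s ε Z = 0), (s : EReal)

/-- The weighted Bowen premeasure `W^s_{N,ε}(T,f,g)`: the infimum of
`∑ c_i exp(-n_i s + sup_{B_{n_i}^T(x_i,ε)} S_{n_i}^T f)` over all countable families
`{(B_{n_i}^T(x_i,ε), c_i)}` with `0 < c_i`, `n_i ≥ N` and `∑ c_i χ_{B_i} ≥ g`. -/
noncomputable def wBowenPre (T : ∀ k, X k → X (k + 1)) (f : ∀ k, X k → ℝ)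
    (s : ℝ) (N : ℕ) (ε : ℝ) (g : X 0 → ℝ) : ℝ≥0∞ :=
  ⨅ (D : Set ((X 0 × ℕ) × ℝ)) (_ : D.Countable)
      (_ : ∀ p ∈ D, N ≤ p.1.2 ∧ 0 < p.2)
      (_ : ∀ x : X 0, ENNReal.ofReal (g x) ≤
        ∑' p : D, (bowenBall T p.1.1.2 ε p.1.1.1).indicator
          (fun _ => ENNReal.ofReal p.1.2) x),
    ∑' p : D, ENNReal.ofReal p.1.2 *
      ENNReal.ofReal
        (Real.exp (-(p.1.1.2 : ℝ) * s + supBirk T f p.1.1.2 (bowenBall T p.1.1.2 ε p.1.1.1)))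

/-- `D` is a countable `(N,ε)`-packing of `Z`: the closed Bowen balls
`B̄_{n}^T(x,ε)`, `(x,n) ∈ D`, are pairwise disjoint with centers in `Z` and orders `≥ N`. -/
def IsPacking (T : ∀ k, X k → X (k + 1)) (N : ℕ) (ε : ℝ) (Z : Set (X 0))
    (D : Set (X 0 × ℕ)) : Prop :=
  D.Countable ∧ (∀ p ∈ D, p.1 ∈ Z ∧ N ≤ p.2) ∧
    ∀ p ∈ D, ∀ q ∈ D, p ≠ q →
      Disjoint (bowenClosedBall T p.2 ε p.1) (bowenClosedBall T q.2 ε q.1)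

/-- The packing premeasure `P^s_{N,ε}(T,f,Z)`: the supremum of
`∑ exp(-n_i s + S_{n_i}^T f(x_i))` over all countable `(N,ε)`-packings of `Z`. -/
noncomputable def packPre (T : ∀ k, X k → X (k + 1)) (f : ∀ k, X k → ℝ)
    (s : ℝ) (N : ℕ) (ε : ℝ) (Z : Set (X 0)) : ℝ≥0∞ :=
  ⨆ (D : Set (X 0 × ℕ)) (_ : IsPacking T N ε Z D),
    ∑' p : D, ENNReal.ofReal (Real.exp (-(p.1.2 : ℝ) * s + birk T f p.1.2 p.1.1))

/-- `P^s_{∞,ε}(T,f,Z) = lim_{N→∞} P^s_{N,ε}(T,f,Z)` (a decreasing limit). -/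
noncomputable def packPreInf (T : ∀ k, X k → X (k + 1)) (f : ∀ k, X k → ℝ)
    (s : ℝ) (ε : ℝ) (Z : Set (X 0)) : ℝ≥0∞ :=
  ⨅ N : ℕ, packPre T f s N ε Z

/-- The packing measure-like quantity
`P^s_ε(T,f,Z) = inf { ∑_i P^s_{∞,ε}(T,f,Z_i) : Z ⊆ ⋃_i Z_i }`. -/
noncomputable def packMeasure (T : ∀ k, X k → X (k + 1)) (f : ∀ k, X k → ℝ)
    (s : ℝ) (ε : ℝ) (Z : Set (X 0)) : ℝ≥0∞ :=
  ⨅ (Zs : ℕ → Set (X 0)) (_ : Z ⊆ ⋃ i, Zs i), ∑' i, packPreInf T f s ε (Zs i)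

/-- The critical value `P^P(T,f,Z,ε) = inf {s : P^s_ε(T,f,Z) = 0}`. -/
noncomputable def packCrit (T : ∀ k, X k → X (k + 1)) (f : ∀ k, X k → ℝ)
    (ε : ℝ) (Z : Set (X 0)) : EReal :=
  ⨅ (s : ℝ) (_ : packMeasure T f s ε Z = 0), (s : EReal)

/-- The packing topological pressure `P^P(T,f,Z) = lim_{ε→0} P^P(T,f,Z,ε)`. -/
noncomputable def packP (T : ∀ k, X k → X (k + 1)) (f : ∀ k, X k → ℝ)
    (Z : Set (X 0)) : EReal :=
  ⨆ (ε : ℝ) (_ : 0 < ε), packCrit T f ε Z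

/-- The packing topological entropy `h^P(T,Z) = P^P(T,0,Z)`. -/
noncomputable def packEnt (T : ∀ k, X k → X (k + 1)) (Z : Set (X 0)) : EReal :=
  packP T (fun k => fun _ : X k => (0 : ℝ)) Z

/-- The packing premeasure `Q^s_{N,ε}(T,f,Z)` using suprema of Birkhoff sums over the balls. -/
noncomputable def qPackPre (T : ∀ k, X k → X (k + 1)) (f : ∀ k, X k → ℝ)
    (s : ℝ) (N : ℕ) (ε : ℝ) (Z : Set (X 0)) : ℝ≥0∞ :=
  ⨆ (D : Set (X 0 × ℕ)) (_ : IsPacking T N ε Z D),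
    ∑' p : D, ENNReal.ofReal
      (Real.exp (-(p.1.2 : ℝ) * s + supBirk T f p.1.2 (bowenClosedBall T p.1.2 ε p.1.1)))

/-- `Q^s_{∞,ε}(T,f,Z) = lim_{N→∞} Q^s_{N,ε}(T,f,Z)`. -/
noncomputable def qPackPreInf (T : ∀ k, X k → X (k + 1)) (f : ∀ k, X k → ℝ)
    (s : ℝ) (ε : ℝ) (Z : Set (X 0)) : ℝ≥0∞ :=
  ⨅ N : ℕ, qPackPre T f s N ε Z

/-- `Q^s_ε(T,f,Z) = inf { ∑_i Q^s_{∞,ε}(T,f,Z_i) : Z ⊆ ⋃_i Z_i }`. -/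
noncomputable def qPackMeasure (T : ∀ k, X k → X (k + 1)) (f : ∀ k, X k → ℝ)
    (s : ℝ) (ε : ℝ) (Z : Set (X 0)) : ℝ≥0∞ :=
  ⨅ (Zs : ℕ → Set (X 0)) (_ : Z ⊆ ⋃ i, Zs i), ∑' i, qPackPreInf T f s ε (Zs i)

/-- The critical value `Q^P(T,f,Z,ε) = inf {s : Q^s_ε(T,f,Z) = 0}`. -/
noncomputable def qPackCrit (T : ∀ k, X k → X (k + 1)) (f : ∀ k, X k → ℝ)
    (ε : ℝ) (Z : Set (X 0)) : EReal :=
  ⨅ (s : ℝ) (_ : qPackMeasure T f s ε Z = 0), (s : EReal)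

end Metric

/-- The distance function of an explicitly given metric space structure. -/
def mdist {α : Type*} (m : MetricSpace α) (x y : α) : ℝ :=
  @dist α m.toPseudoMetricSpace.toDist x y

section PackingBillingsley

variable [∀ k, MetricSpace (X k)]

theorem continuous_iter {T : ∀ k, X k → X (k + 1)} (hT : ∀ k, Continuous (T k)) (j : ℕ) :
    Continuous (iter T j) := by
  induction j with
  | zero => exact continuous_id
  | succ j ih => exact (hT j).comp ih

theorem isOpen_bowenBall {T : ∀ k, X k → X (k + 1)} (hT : ∀ k, Continuous (T k)) (n : ℕ)
    (ε : ℝ) (x : X 0) : IsOpen (bowenBall T n ε x) := by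
  have h : bowenBall T n ε x = ⋂ j ∈ Set.Iio n, {y | dist (iter T j x) (iter T j y) < ε} := by
    ext y
    simp [bowenBall]
  rw [h]
  exact (Set.finite_Iio n).isOpen_biInter fun j _ =>
    isOpen_lt (continuous_const.dist (continuous_iter hT j)) continuous_const

theorem isClosed_bowenClosedBall {T : ∀ k, X k → X (k + 1)} (hT : ∀ k, Continuous (T k)) (n : ℕ)
    (ε : ℝ) (x : X 0) : IsClosed (bowenClosedBall T n ε x) := by
  have h : bowenClosedBall T n ε x =
      ⋂ j ∈ Set.Iio n, {y | dist (iter T j x) (iter T j y) ≤ ε} := by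
    ext y
    simp [bowenClosedBall]
  rw [h]
  exact isClosed_biInter fun j _ =>
    isClosed_le (continuous_const.dist (continuous_iter hT j)) continuous_const

theorem mem_bowenBall_self (T : ∀ k, X k → X (k + 1)) (n : ℕ) {ε : ℝ} (hε : 0 < ε) (x : X 0) :
    x ∈ bowenBall T n ε x := fun j _ => by simpa using hε

theorem bowenBall_subset_bowenClosedBall (T : ∀ k, X k → X (k + 1)) (n : ℕ) (ε : ℝ) (x : X 0) :
    bowenBall T n ε x ⊆ bowenClosedBall T n ε x := fun _ hy j hj => (hy j hj).le

theorem bowenBall_mono (T : ∀ k, X k → X (k + 1)) (n : ℕ) {ε ε' : ℝ} (h : ε ≤ ε') (x : X 0) :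
    bowenBall T n ε x ⊆ bowenBall T n ε' x := fun _ hy j hj => (hy j hj).trans_le h

theorem inv_mul_neg_elog_add (n : ℕ) {m : ℝ≥0∞} (h0 : m ≠ 0) (hm : m ≠ ⊤) (S : ℝ) :
    (((n : ℝ)⁻¹ : ℝ) : EReal) * (-(elog m) + (S : EReal)) =
      ((n : ℝ)⁻¹ * (-Real.log m.toReal + S) : ℝ) := by
  simp only [elog, h0, hm, if_false]
  norm_cast

theorem inv_mul_neg_elog_zero_add {n : ℕ} (hn : 0 < n) (S : ℝ) :
    (((n : ℝ)⁻¹ : ℝ) : EReal) * (-(elog 0) + (S : EReal)) = ⊤ := by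
  have : (0 : ℝ) < (n : ℝ)⁻¹ := by positivity
  simp [elog, EReal.coe_mul_top_of_pos this]

theorem ofReal_exp_le_of_inv_mul_le {n : ℕ} (hn : 0 < n) {m : ℝ≥0∞} (hm : m ≠ ⊤) {S t : ℝ}
    (h : (((n : ℝ)⁻¹ : ℝ) : EReal) * (-(elog m) + (S : EReal)) ≤ (t : EReal)) :
    ENNReal.ofReal (Real.exp (-(n : ℝ) * t + S)) ≤ m := by
  rcases eq_or_ne m 0 with rfl | h0
  · rw [inv_mul_neg_elog_zero_add hn] at h
    simp at h
  · have hn' : (0 : ℝ) < n := by positivity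
    have hpos : 0 < m.toReal := ENNReal.toReal_pos h0 hm
    rw [inv_mul_neg_elog_add n h0 hm, EReal.coe_le_coe_iff, inv_mul_le_iff₀ hn'] at h
    apply ENNReal.ofReal_le_of_le_toReal
    rw [← Real.le_log_iff_exp_le hpos]
    linarith

theorem le_ofReal_exp_of_le_inv_mul {n : ℕ} (hn : 0 < n) {m : ℝ≥0∞} (hm : m ≠ ⊤) {S t : ℝ}
    (h : (t : EReal) ≤ (((n : ℝ)⁻¹ : ℝ) : EReal) * (-(elog m) + (S : EReal))) :
    m ≤ ENNReal.ofReal (Real.exp (-(n : ℝ) * t + S)) := by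
  rcases eq_or_ne m 0 with rfl | h0
  · simp
  · have hn' : (0 : ℝ) < n := by positivity
    have hpos : 0 < m.toReal := ENNReal.toReal_pos h0 hm
    rw [inv_mul_neg_elog_add n h0 hm, EReal.coe_le_coe_iff, le_inv_mul_iff₀ hn'] at h
    apply ENNReal.le_ofReal_iff_toReal_le hm (Real.exp_pos _).le |>.2
    rw [← Real.log_le_iff_le_exp hpos]
    linarith

theorem ofReal_exp_split (n : ℕ) (t t' S : ℝ) :
    ENNReal.ofReal (Real.exp (-(n : ℝ) * t + S)) =
      ENNReal.ofReal (Real.exp (-(n : ℝ) * (t - t'))) *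
        ENNReal.ofReal (Real.exp (-(n : ℝ) * t' + S)) := by
  rw [← ENNReal.ofReal_mul (Real.exp_pos _).le, ← Real.exp_add]
  congr 2
  ring

theorem IsPacking.mono {T : ∀ k, X k → X (k + 1)} {M N : ℕ} {ε : ℝ} {Y Z : Set (X 0)}
    {D : Set (X 0 × ℕ)} (hD : IsPacking T N ε Y D) (hMN : M ≤ N) (hYZ : Y ⊆ Z) :
    IsPacking T M ε Z D :=
  ⟨hD.1, fun p hp => ⟨hYZ (hD.2.1 p hp).1, hMN.trans (hD.2.1 p hp).2⟩, hD.2.2⟩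

theorem packPre_mono (T : ∀ k, X k → X (k + 1)) (f : ∀ k, X k → ℝ) (s : ℝ) {M N : ℕ} (ε : ℝ)
    {Y Z : Set (X 0)} (hMN : M ≤ N) (hYZ : Y ⊆ Z) :
    packPre T f s N ε Y ≤ packPre T f s M ε Z :=
  iSup₂_le fun D hD => le_iSup₂_of_le D (hD.mono hMN hYZ) le_rfl

theorem packPreInf_mono (T : ∀ k, X k → X (k + 1)) (f : ∀ k, X k → ℝ) (s ε : ℝ)
    {Y Z : Set (X 0)} (hYZ : Y ⊆ Z) : packPreInf T f s ε Y ≤ packPreInf T f s ε Z :=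
  iInf_mono fun _ => packPre_mono T f s ε le_rfl hYZ

/-- A disjoint family of closed Bowen balls of fixed order, centred in `Z`, whose enlargements
cover `Z`. -/
theorem exists_isPacking_cover [CompactSpace (X 0)] {T : ∀ k, X k → X (k + 1)}
    (hT : ∀ k, Continuous (T k)) (n : ℕ) {ε : ℝ} (hε : 0 < ε) (Z : Set (X 0)) :
    ∃ u : Set (X 0), IsPacking T n (ε / 4) Z ((fun x => (x, n)) '' u) ∧ u.Countable ∧ u ⊆ Z ∧
      Z ⊆ ⋃ x ∈ u, bowenBall T n ε x := by
  have hε4 : 0 < ε / 4 := by positivity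
  have hmem := fun x => mem_bowenBall_self T n hε4 x
  obtain ⟨u, huZ, hu, hcov⟩ := Vitali.exists_disjoint_subfamily_covering_enlargement
    (bowenClosedBall T n (ε / 4)) Z (fun _ => 1) 2 one_lt_two (fun _ _ => zero_le_one) 1
    (fun _ _ => le_rfl) (fun x _ => ⟨x, bowenBall_subset_bowenClosedBall _ _ _ _ (hmem x)⟩)
  have hcount : u.Countable := by
    refine hu.countable_of_nonempty_interior fun x _ => ⟨x, ?_⟩
    exact mem_interior.2 ⟨_, bowenBall_subset_bowenClosedBall _ _ _ _,
      isOpen_bowenBall hT _ _ _, hmem x⟩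
  refine ⟨u, ⟨hcount.image _, ?_, ?_⟩, hcount, huZ, fun x hx => ?_⟩
  · rintro _ ⟨x, hx, rfl⟩
    exact ⟨huZ hx, le_rfl⟩
  · rintro _ ⟨x, hx, rfl⟩ _ ⟨y, hy, rfl⟩ hxy
    exact hu hx hy fun h => hxy (by rw [h])
  · obtain ⟨y, hy, ⟨z, hzx, hzy⟩, -⟩ := hcov x hx
    refine mem_iUnion₂.2 ⟨y, hy, fun j hj => ?_⟩
    have := dist_triangle_right (iter T j y) (iter T j x) (iter T j z)
    linarith [hzx j hj, hzy j hj]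

variable [MeasurableSpace (X 0)]

theorem measure_le_mul_packPre [CompactSpace (X 0)] {T : ∀ k, X k → X (k + 1)}
    (hT : ∀ k, Continuous (T k)) (f : ∀ k, X k → ℝ) (μ : Measure (X 0)) (t t' : ℝ) (n : ℕ)
    {ε : ℝ} (hε : 0 < ε) {Z : Set (X 0)} (hZ : ∀ x ∈ Z, μ (bowenBall T n ε x) ≤
      ENNReal.ofReal (Real.exp (-(n : ℝ) * t' + birk T f n x))) :
    μ Z ≤ ENNReal.ofReal (Real.exp (-(n : ℝ) * (t' - t))) * packPre T f t n (ε / 4) Z := by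
  obtain ⟨u, hpack, hcount, huZ, hcov⟩ := exists_isPacking_cover hT n hε Z
  calc μ Z ≤ ∑' x : u, μ (bowenBall T n ε x) :=
        (measure_mono hcov).trans (measure_biUnion_le μ hcount _)
    _ ≤ ∑' x : u, ENNReal.ofReal (Real.exp (-(n : ℝ) * (t' - t))) *
          ENNReal.ofReal (Real.exp (-(n : ℝ) * t + birk T f n x)) :=
        ENNReal.tsum_le_tsum fun x => (hZ x (huZ x.2)).trans (ofReal_exp_split _ _ _ _).le
    _ = ENNReal.ofReal (Real.exp (-(n : ℝ) * (t' - t))) *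
          ∑' p : (fun x => (x, n)) '' u,
            ENNReal.ofReal (Real.exp (-(p.1.2 : ℝ) * t + birk T f p.1.2 p.1.1)) := by
        rw [ENNReal.tsum_mul_left, tsum_image
          (fun p : X 0 × ℕ => ENNReal.ofReal (Real.exp (-(p.2 : ℝ) * t + birk T f p.2 p.1)))
          (fun x _ y _ h => congrArg Prod.fst h)]
    _ ≤ _ := by
        gcongr
        exact le_iSup₂_of_le _ hpack le_rfl

/-- If the balls centred in `Z` frequently have mass at most `exp (-n t' + S_n f)` and `μ Z > 0`,
then the packing premeasure of `Z` is infinite at every exponent `t < t'`. -/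
theorem packPreInf_eq_top [CompactSpace (X 0)] {T : ∀ k, X k → X (k + 1)}
    (hT : ∀ k, Continuous (T k)) (f : ∀ k, X k → ℝ) (μ : Measure (X 0)) {t t' : ℝ} (htt : t < t')
    {ε : ℝ} (hε : 0 < ε) {Z : Set (X 0)} (hμ : μ Z ≠ 0)
    (hZ : ∀ x ∈ Z, ∃ᶠ n in atTop, μ (bowenBall T n ε x) ≤
      ENNReal.ofReal (Real.exp (-(n : ℝ) * t' + birk T f n x))) :
    packPreInf T f t (ε / 4) Z = ⊤ := by
  refine iInf_eq_top.2 fun M => ?_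
  by_contra hfin
  set a : ℕ → ℝ≥0∞ := fun n => ENNReal.ofReal (Real.exp (-(n : ℝ) * (t' - t)))
  have ha : ∑' n, a n ≠ ⊤ := by
    refine (Summable.congr (Real.summable_exp_nat_mul_iff.2 (neg_lt_zero.2 (sub_pos.2 htt)))
      fun n => ?_).tsum_ofReal_ne_top
    ring_nf
  have hbound : ∀ N ≥ M, μ Z ≤ (∑' k, a (k + N)) * packPre T f t M (ε / 4) Z := by
    intro N hN
    let W : ℕ → Set (X 0) := fun k => {x ∈ Z | μ (bowenBall T (k + N) ε x) ≤
      ENNReal.ofReal (Real.exp (-((k + N : ℕ) : ℝ) * t' + birk T f (k + N) x))}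
    have hcov : Z ⊆ ⋃ k, W k := fun x hx => by
      obtain ⟨n, hn, hx'⟩ := frequently_atTop.1 (hZ x hx) N
      obtain ⟨k, rfl⟩ := Nat.exists_eq_add_of_le' hn
      exact mem_iUnion.2 ⟨k, hx, hx'⟩
    calc μ Z ≤ ∑' k, μ (W k) := (measure_mono hcov).trans (measure_iUnion_le _)
      _ ≤ ∑' k, a (k + N) * packPre T f t M (ε / 4) Z := by
          refine ENNReal.tsum_le_tsum fun k =>
            (measure_le_mul_packPre hT f μ t t' (k + N) hε fun x hx => hx.2).trans ?_
          exact mul_le_mul_right (packPre_mono T f t _ (by omega) (sep_subset _ _)) _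
      _ = _ := ENNReal.tsum_mul_right
  have hlim := ENNReal.Tendsto.mul_const (ENNReal.tendsto_sum_nat_add a ha)
    (Or.inr hfin : (0 : ℝ≥0∞) ≠ 0 ∨ packPre T f t M (ε / 4) Z ≠ ⊤)
  rw [zero_mul] at hlim
  exact hμ (le_antisymm (ge_of_tendsto hlim (eventually_atTop.2 ⟨M, hbound⟩)) bot_le)

theorem le_packP_of_le_localUpperPres [CompactSpace (X 0)] {T : ∀ k, X k → X (k + 1)}
    (hT : ∀ k, Continuous (T k)) (f : ∀ k, X k → ℝ) (μ : Measure (X 0)) [IsFiniteMeasure μ]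
    {E : Set (X 0)} {s : ℝ}
    (h : ∀ x ∈ E, (s : EReal) ≤ localUpperPres μ T f x) (hE : μ E ≠ 0) :
    (s : EReal) ≤ packP T f E := by
  refine EReal.ge_of_forall_gt_iff_ge.1 fun t' hts => ?_
  let A : ℕ → Set (X 0) := fun k => {x | ∃ᶠ n in atTop, μ (bowenBall T n (1 / ((k : ℝ) + 1)) x) ≤
    ENNReal.ofReal (Real.exp (-(n : ℝ) * t' + birk T f n x))}
  have hcov : E ⊆ ⋃ k, A k := fun x hx => by
    obtain ⟨ε, hlt⟩ := lt_iSup_iff.1 (hts.trans_le (h x hx))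
    obtain ⟨hε, hlt⟩ := lt_iSup_iff.1 hlt
    obtain ⟨k, hk⟩ := exists_nat_one_div_lt hε
    refine mem_iUnion.2 ⟨k, ((frequently_lt_of_lt_limsup (by isBoundedDefault) hlt).and_eventually
      (eventually_gt_atTop 0)).mono fun n hn => ?_⟩
    exact (measure_mono (bowenBall_mono T n hk.le x)).trans
      (le_ofReal_exp_of_le_inv_mul hn.2 (measure_ne_top _ _) hn.1.le)
  obtain ⟨k, hk⟩ : ∃ k, μ (E ∩ A k) ≠ 0 := by
    by_contra! hzero
    refine hE (measure_mono_null ?_ (measure_iUnion_null hzero))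
    rw [← inter_iUnion]
    exact subset_inter Subset.rfl hcov
  have hε : 0 < 1 / ((k : ℝ) + 1) := by positivity
  refine le_iSup₂_of_le (1 / ((k : ℝ) + 1) / 4) (by positivity) (le_iInf₂ fun t ht => ?_)
  by_contra! htt
  rw [EReal.coe_lt_coe_iff] at htt
  suffices packMeasure T f t (1 / ((k : ℝ) + 1) / 4) E = ⊤ from
    ENNReal.top_ne_zero (this.symm.trans ht)
  refine iInf₂_eq_top.2 fun Zs hZs => ?_
  obtain ⟨i, hi⟩ : ∃ i, μ (E ∩ A k ∩ Zs i) ≠ 0 := by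
    by_contra! hzero
    refine hk (measure_mono_null ?_ (measure_iUnion_null hzero))
    rw [← inter_iUnion]
    exact subset_inter Subset.rfl (inter_subset_left.trans hZs)
  refine ENNReal.tsum_eq_top_of_eq_top ⟨i, top_unique ?_⟩
  rw [← packPreInf_eq_top hT f μ htt hε hi fun x hx => hx.1.2]
  exact packPreInf_mono T f t _ inter_subset_right

variable [BorelSpace (X 0)]

theorem IsPacking.tsum_measure_le_one {T : ∀ k, X k → X (k + 1)} (hT : ∀ k, Continuous (T k))
    (μ : Measure (X 0)) [IsProbabilityMeasure μ] {N : ℕ} {ε : ℝ} {Z : Set (X 0)}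
    {D : Set (X 0 × ℕ)} (hD : IsPacking T N ε Z D) :
    ∑' p : D, μ (bowenClosedBall T p.1.2 ε p.1.1) ≤ 1 := by
  refine (tsum_measure_le_measure_univ (μ := μ)
    (fun p : D => (isClosed_bowenClosedBall hT _ _ _).nullMeasurableSet) ?_).trans measure_univ.le
  intro p q hpq
  exact (hD.2.2 p p.2 q q.2 fun h => hpq (Subtype.ext h)).aedisjoint

/-- If the balls centred in `Z` have mass at least `exp (-n t' + S_n f)` for all `n ≥ m`, then the
packing premeasure of `Z` vanishes at every exponent `t > t'`. -/
theorem packPreInf_eq_zero {T : ∀ k, X k → X (k + 1)} (hT : ∀ k, Continuous (T k))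
    (f : ∀ k, X k → ℝ) (μ : Measure (X 0)) [IsProbabilityMeasure μ] {t t' : ℝ} (htt : t' < t)
    {ε : ℝ} {Z : Set (X 0)} {m : ℕ}
    (hZ : ∀ x ∈ Z, ∀ n ≥ m, ENNReal.ofReal (Real.exp (-(n : ℝ) * t' + birk T f n x)) ≤
      μ (bowenBall T n ε x)) : packPreInf T f t ε Z = 0 := by
  have hbound : ∀ N ≥ m, packPre T f t N ε Z ≤
      ENNReal.ofReal (Real.exp (-(N : ℝ) * (t - t'))) := by
    intro N hN
    refine iSup₂_le fun D hD => ?_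
    calc ∑' p : D, ENNReal.ofReal (Real.exp (-(p.1.2 : ℝ) * t + birk T f p.1.2 p.1.1))
        ≤ ∑' p : D, ENNReal.ofReal (Real.exp (-(N : ℝ) * (t - t'))) *
            μ (bowenClosedBall T p.1.2 ε p.1.1) := by
          refine ENNReal.tsum_le_tsum fun p => ?_
          obtain ⟨hpZ, hpN⟩ := hD.2.1 p p.2
          have hpN' : (N : ℝ) ≤ p.1.2 := by exact_mod_cast hpN
          rw [ofReal_exp_split _ t t']
          refine mul_le_mul' (ENNReal.ofReal_le_ofReal (Real.exp_le_exp.2 ?_)) ?_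
          · nlinarith
          · exact (hZ _ hpZ _ (hN.trans hpN)).trans
              (measure_mono (bowenBall_subset_bowenClosedBall _ _ _ _))
      _ = ENNReal.ofReal (Real.exp (-(N : ℝ) * (t - t'))) *
            ∑' p : D, μ (bowenClosedBall T p.1.2 ε p.1.1) := ENNReal.tsum_mul_left
      _ ≤ ENNReal.ofReal (Real.exp (-(N : ℝ) * (t - t'))) :=
          mul_le_of_le_one_right' (hD.tsum_measure_le_one hT μ)
  have hlim : Tendsto (fun N : ℕ => ENNReal.ofReal (Real.exp (-(N : ℝ) * (t - t')))) atTop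
      (𝓝 0) := by
    rw [← ENNReal.ofReal_zero]
    refine ENNReal.tendsto_ofReal (Real.tendsto_exp_atBot.comp ?_)
    simp only [neg_mul]
    exact tendsto_neg_atTop_atBot.comp
      (tendsto_natCast_atTop_atTop.atTop_mul_const (sub_pos.2 htt))
  refine le_antisymm (ge_of_tendsto hlim ?_) bot_le
  filter_upwards [eventually_ge_atTop m] with N hN
  exact (iInf_le _ N).trans (hbound N hN)

theorem packP_le_of_localUpperPres_le {T : ∀ k, X k → X (k + 1)} (hT : ∀ k, Continuous (T k))
    (f : ∀ k, X k → ℝ) (μ : Measure (X 0)) [IsProbabilityMeasure μ] {E : Set (X 0)} {s : ℝ}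
    (h : ∀ x ∈ E, localUpperPres μ T f x ≤ (s : EReal)) : packP T f E ≤ (s : EReal) := by
  refine iSup₂_le fun ε hε => EReal.le_of_forall_lt_iff_le.1 fun t hst => ?_
  rw [EReal.coe_lt_coe_iff] at hst
  obtain ⟨t', hst', htt⟩ := exists_between hst
  suffices hzero : packMeasure T f t ε E ≤ 0 from iInf₂_le t (nonpos_iff_eq_zero.1 hzero)
  refine iInf₂_le_of_le
    (fun m => {x | ∀ n ≥ m, ENNReal.ofReal (Real.exp (-(n : ℝ) * t' + birk T f n x)) ≤
      μ (bowenBall T n ε x)}) (fun x hx => ?_) ?_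
  · have hlt := ((le_iSup₂ ε hε).trans (h x hx)).trans_lt (EReal.coe_lt_coe_iff.2 hst')
    obtain ⟨m, hm⟩ := eventually_atTop.1
      ((eventually_lt_of_limsup_lt hlt).and (eventually_gt_atTop 0))
    exact mem_iUnion.2 ⟨m, fun n hn =>
      ofReal_exp_le_of_inv_mul_le (hm n hn).2 (measure_ne_top _ _) (hm n hn).1.le⟩
  · exact (ENNReal.tsum_eq_zero.2 fun m => packPreInf_eq_zero hT f μ htt fun x hx => hx).le

end PackingBillingsley

end NDS

open NDS in
/-- Billingsley type theorem for the packing pressure.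
(1) If `P̄_μ(T,f,x) ≤ s` for all `x ∈ E`, then `P^P(T,f,E) ≤ s`.
(2) If `f` is equicontinuous, `P̄_μ(T,f,x) ≥ s` for all `x ∈ E` and `μ(E) > 0`,
then `P^P(T,f,E) ≥ s`. -/
theorem stmt4 {X : ℕ → Type*} [∀ k, MetricSpace (X k)] [∀ k, CompactSpace (X k)]
    [MeasurableSpace (X 0)] [BorelSpace (X 0)]
    (T : ∀ k, X k → X (k + 1)) (hT : ∀ k, Continuous (T k))
    (f : ∀ k, X k → ℝ) (hf : ∀ k, Continuous (f k))
    (E : Set (X 0)) (hE : MeasurableSet E) (s : ℝ)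
    (μ : MeasureTheory.Measure (X 0)) [MeasureTheory.IsProbabilityMeasure μ] :
    ((∀ x ∈ E, localUpperPres μ T f x ≤ (s : EReal)) → packP T f E ≤ (s : EReal)) ∧
    (EquicontPotential f → (∀ x ∈ E, (s : EReal) ≤ localUpperPres μ T f x) → 0 < μ E →
      (s : EReal) ≤ packP T f E) := by
  exact ⟨packP_le_of_localUpperPres_le hT f μ,
    fun _ h hμ => le_packP_of_le_localUpperPres hT f μ h hμ.ne'⟩
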